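/- arXiv:1901.06271 — 5 statements merged into one kernel-verified Lean document; each statement's English description precedes it below -/
import Mathlib

section
/- Fix 0 < α, β < 1 and n ∈ ℕ, and let y be an integer with 0 ≤ y ≤ n-1. Then the one-sided limit lim_{x→1⁻} [ (1-x)^y , (1-x)^{-α+n-1-y} ]_n(x) exists, is finite, and is nonzero; likewise the one-sided limit lim_{x→-1⁺} [ (1+x)^y , (1+x)^{-β+n-1-y} ]_n(x) exists, is finite, and is nonzero. (Consequently the functions behaving like (1-x)^y, (1-x)^{-α+y} near 1 and (1+x)^y, (1+x)^{-β+y} near -1, for 0 ≤ y < n, do NOT lie in the minimal domain of the n-th power of the Jacobi expression.) -/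
open MeasureTheory Set Filter Topology

/-- Membership in the weighted space `L²_{α,β}(-1,1)`. -/
def MemL2ab (α β : ℝ) (f : ℝ → ℂ) : Prop :=
  IntegrableOn (fun x : ℝ => ‖f x‖ ^ 2 * (1 - x) ^ α * (1 + x) ^ β) (Ioo (-1 : ℝ) 1)

/-- The Jacobi differential expression
`ℓ_{α,β}[f](x) = -(1-x)^{-α}(1+x)^{-β}·[(1-x)^{α+1}(1+x)^{β+1} f'(x)]'`. -/
noncomputable def jacobiL (α β : ℝ) (f : ℝ → ℂ) : ℝ → ℂ := fun x =>
  -((((1 - x) ^ (-α) * (1 + x) ^ (-β) : ℝ) : ℂ) *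
    deriv (fun y : ℝ => (((1 - y) ^ (α + 1) * (1 + y) ^ (β + 1) : ℝ) : ℂ) * deriv f y) x)

/-- The maximal domain `D_max^{J,n}` of the `n`-th power of the Jacobi expression:
`C^{2n}` functions on `(-1,1)` with `f ∈ L²_{α,β}` and `ℓ^n_{α,β}[f] ∈ L²_{α,β}`. -/
def JacobiMaxDom (α β : ℝ) (n : ℕ) (f : ℝ → ℂ) : Prop :=
  ContDiffOn ℝ (2 * n) f (Ioo (-1 : ℝ) 1) ∧ MemL2ab α β f ∧
    MemL2ab α β ((jacobiL α β)^[n] f)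

/-- The coefficient function `a_k(x) = (1-x)^{α+k}(1+x)^{β+k}`. -/
noncomputable def ak (α β : ℝ) (k : ℕ) (x : ℝ) : ℝ :=
  (1 - x) ^ (α + (k : ℝ)) * (1 + x) ^ (β + (k : ℝ))

/-- The `n`-th Jacobi sesquilinear form (for real-valued `g`; no conjugation):
`[f,g]_n(x) = Σ_{k=1}^{n} Σ_{j=1}^{k} (-1)^{k+j} { (a_k g^{(k)})^{(k-j)} f^{(j-1)}
 − (a_k f^{(k)})^{(k-j)} g^{(j-1)} }`. -/
noncomputable def sesq (α β : ℝ) (n : ℕ) (f g : ℝ → ℂ) (x : ℝ) : ℂ :=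
  ∑ k ∈ Finset.Icc 1 n, ∑ j ∈ Finset.Icc 1 k, (-1 : ℂ) ^ (k + j) *
    (iteratedDeriv (k - j) (fun y => ((ak α β k y : ℝ) : ℂ) * iteratedDeriv k g y) x *
        iteratedDeriv (j - 1) f x -
      iteratedDeriv (k - j) (fun y => ((ak α β k y : ℝ) : ℂ) * iteratedDeriv k f y) x *
        iteratedDeriv (j - 1) g x)


/-- Falling factorial as a real number. -/
noncomputable def fallF (r : ℝ) (m : ℕ) : ℝ := ∏ i ∈ Finset.range m, (r - (i : ℝ))

lemma deriv_form (r : ℝ) (W : ℝ → ℂ) (hW : ContDiffOn ℝ ((⊤ : ℕ∞) : WithTop ℕ∞) W (Iio 1))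
    (F : ℝ → ℂ) (hF : ∀ x ∈ Ioo (-1 : ℝ) 1, F x = (((1 + x) ^ r : ℝ) : ℂ) * W x) (m : ℕ) :
    ∃ V : ℝ → ℂ, ContDiffOn ℝ ((⊤ : ℕ∞) : WithTop ℕ∞) V (Iio 1) ∧
      (∀ x ∈ Ioo (-1 : ℝ) 1, iteratedDeriv m F x = (((1 + x) ^ (r - m) : ℝ) : ℂ) * V x) ∧
      V (-1) = (fallF r m : ℂ) * W (-1) := by
  induction m with
  | zero => exact ⟨W, hW, by simpa using hF, by simp [fallF]⟩
  | succ m ih =>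
    obtain ⟨V, hV, hVe, hV1⟩ := ih
    refine ⟨fun x => ((r - m : ℝ) : ℂ) * V x + ((1 + x : ℝ) : ℂ) * deriv V x, ?_, ?_, ?_⟩
    · have hd : ContDiffOn ℝ ((⊤ : ℕ∞) : WithTop ℕ∞) (deriv V) (Iio 1) :=
        hV.deriv_of_isOpen isOpen_Iio (by simp)
      have hl : ContDiff ℝ ((⊤ : ℕ∞) : WithTop ℕ∞) (fun x : ℝ => ((1 + x : ℝ) : ℂ)) :=
        Complex.ofRealCLM.contDiff.comp (contDiff_const.add contDiff_id)
      exact (contDiffOn_const.mul hV).add (hl.contDiffOn.mul hd)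
    · intro x hx
      have hpos : 0 < 1 + x := by linarith [hx.1]
      rw [iteratedDeriv_succ]
      have he : iteratedDeriv m F =ᶠ[𝓝 x] fun x => (((1 + x) ^ (r - m) : ℝ) : ℂ) * V x := by
        filter_upwards [isOpen_Ioo.mem_nhds hx] with z hz using hVe z hz
      rw [he.deriv_eq]
      have hVd : HasDerivAt V (deriv V x) x :=
        ((hV.differentiableOn (by simp)).differentiableAt (isOpen_Iio.mem_nhds hx.2)).hasDerivAt
      have h1 : HasDerivAt (fun x : ℝ => (1 + x) ^ (r - m)) (1 * (r - m) * (1 + x) ^ (r - m - 1)) x :=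
        ((hasDerivAt_id x).const_add 1).rpow_const (Or.inl hpos.ne')
      have h2 := h1.ofReal_comp.mul hVd
      rw [show deriv (fun x => (((1 + x) ^ (r - m) : ℝ) : ℂ) * V x) x = _ from h2.deriv]
      have e1 : r - ((m + 1 : ℕ) : ℝ) = r - m - 1 := by push_cast; ring
      have e2 : (1 + x) ^ (r - m) = (1 + x) ^ (r - m - 1) * (1 + x) := by
        rw [← Real.rpow_add_one hpos.ne']; ring_nf
      rw [e1, e2]
      push_cast
      ring
    · simp only [hV1, fallF, Finset.prod_range_succ]
      push_cast
      ring

lemma term_lim (α β : ℝ) (n k j : ℕ) (hj : 1 ≤ j) (hjk : j ≤ k) (hk : k ≤ n) (p q : ℝ)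
    (hpq : p + q + β + 1 = n) :
    Tendsto (fun x => iteratedDeriv (k - j) (fun y => ((ak α β k y : ℝ) : ℂ) *
        iteratedDeriv k (fun x : ℝ => (((1 + x) ^ q : ℝ) : ℂ)) y) x *
        iteratedDeriv (j - 1) (fun x : ℝ => (((1 + x) ^ p : ℝ) : ℂ)) x) (𝓝[>] (-1 : ℝ))
      (𝓝 (if k = n then ((fallF q k * fallF (q + β) (k - j) * fallF p (j - 1)
        * 2 ^ (α + k) : ℝ) : ℂ) else 0)) := by
  obtain ⟨G, hG, hGe, hG1⟩ := deriv_form q (fun _ => 1) contDiffOn_const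
    (fun x : ℝ => (((1 + x) ^ q : ℝ) : ℂ)) (by simp) k
  obtain ⟨P, hP, hPe, hP1⟩ := deriv_form p (fun _ => 1) contDiffOn_const
    (fun x : ℝ => (((1 + x) ^ p : ℝ) : ℂ)) (by simp) (j - 1)
  have hw : ContDiffOn ℝ ((⊤ : ℕ∞) : WithTop ℕ∞)
      (fun x : ℝ => (((1 - x) ^ (α + k) : ℝ) : ℂ)) (Iio 1) := by
    refine Complex.ofRealCLM.contDiff.comp_contDiffOn ?_
    refine ContDiffOn.rpow_const_of_ne (contDiffOn_const.sub contDiffOn_id) ?_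
    intro x hx
    have : x < 1 := hx
    exact sub_ne_zero.2 this.ne'
  obtain ⟨H, hH, hHe, hH1⟩ := deriv_form (q + β)
    (fun x : ℝ => (((1 - x) ^ (α + k) : ℝ) : ℂ) * G x) (hw.mul hG)
    (fun y => ((ak α β k y : ℝ) : ℂ) *
        iteratedDeriv k (fun x : ℝ => (((1 + x) ^ q : ℝ) : ℂ)) y) (by
      intro x hx
      have hpos : 0 < 1 + x := by linarith [hx.1]
      have e : (1 + x) ^ (q + β) = (1 + x) ^ (β + k) * (1 + x) ^ (q - k) := by
        rw [← Real.rpow_add hpos]; ring_nf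
      rw [hGe x hx, ak, e]
      push_cast
      ring) (k - j)
  have hev : (fun x => (((1 + x) ^ (n - k) : ℝ) : ℂ) * (H x * P x)) =ᶠ[𝓝[>] (-1 : ℝ)]
      (fun x => iteratedDeriv (k - j) (fun y => ((ak α β k y : ℝ) : ℂ) *
        iteratedDeriv k (fun x : ℝ => (((1 + x) ^ q : ℝ) : ℂ)) y) x *
        iteratedDeriv (j - 1) (fun x : ℝ => (((1 + x) ^ p : ℝ) : ℂ)) x) := by
    filter_upwards [Ioo_mem_nhdsGT (show (-1 : ℝ) < 1 by norm_num)] with x hx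
    have hpos : 0 < 1 + x := by linarith [hx.1]
    rw [hHe x hx, hPe x hx, ← Real.rpow_natCast,
      show ((n - k : ℕ) : ℝ) = (q + β - ((k - j : ℕ) : ℝ)) + (p - ((j - 1 : ℕ) : ℝ)) by
        rw [Nat.cast_sub hk, Nat.cast_sub hjk, Nat.cast_sub hj, ← hpq]; push_cast; ring,
      Real.rpow_add hpos]
    push_cast
    ring
  refine Tendsto.congr' hev ?_
  have hmem : Iio (1 : ℝ) ∈ 𝓝 (-1 : ℝ) := isOpen_Iio.mem_nhds (by norm_num [Set.mem_Iio])
  have hc1 := hH.continuousOn.continuousAt hmem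
  have hc2 := hP.continuousOn.continuousAt hmem
  have hc0 : ContinuousAt (fun x : ℝ => (((1 + x) ^ (n - k) : ℝ) : ℂ)) (-1) := by fun_prop
  have hlim := ((hc0.mul (hc1.mul hc2)).tendsto).mono_left
    (nhdsWithin_le_nhds (s := Ioi (-1 : ℝ)))
  suffices hval : ((fun x : ℝ => (((1 + x) ^ (n - k) : ℝ) : ℂ)) * (H * P)) (-1) =
      (if k = n then ((fallF q k * fallF (q + β) (k - j) * fallF p (j - 1)
        * 2 ^ (α + k) : ℝ) : ℂ) else 0) by
    rw [← hval]; exact hlim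
  simp only [Pi.mul_apply, hH1, hP1, hG1]
  split_ifs with h
  · subst h
    norm_num
    ring
  · have : n - k ≠ 0 := by omega
    norm_num [this]

lemma fallF_ne (r : ℝ) (m : ℕ) (h : ∀ i : ℕ, r ≠ i) : fallF r m ≠ 0 :=
  Finset.prod_ne_zero_iff.2 fun i _ => sub_ne_zero.2 (h i)

lemma fallF_nat_zero (y m : ℕ) (h : y < m) : fallF y m = 0 :=
  Finset.prod_eq_zero (Finset.mem_range.2 h) (sub_self _)

lemma fallF_nat_self (y : ℕ) : fallF y y ≠ 0 :=
  Finset.prod_ne_zero_iff.2 fun i hi => by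
    have := Finset.mem_range.1 hi
    exact sub_ne_zero.2 (by exact_mod_cast this.ne')

lemma left_side (α β : ℝ) (hβ0 : 0 < β) (hβ1 : β < 1) (n : ℕ) (hn : 1 ≤ n)
    (y : ℕ) (hy : y ≤ n - 1) :
    ∃ L : ℂ, L ≠ 0 ∧
      Tendsto (sesq α β n (fun x : ℝ => (((1 + x) ^ y : ℝ) : ℂ))
          (fun x : ℝ => (((1 + x) ^ (-β + ((n : ℝ) - 1 - (y : ℝ))) : ℝ) : ℂ)))
        (𝓝[>] (-1 : ℝ)) (𝓝 L) := by
  set s : ℝ := -β + ((n : ℝ) - 1 - (y : ℝ)) with hs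
  have hsb : s + β = ((n - 1 - y : ℕ) : ℝ) := by
    rw [Nat.cast_sub hy, Nat.cast_sub hn, hs]; push_cast; ring
  have hs_ne : ∀ i : ℕ, s ≠ i := by
    intro i hi
    have h1 : (β : ℝ) = (((n - 1 - y : ℕ) : ℤ) - (i : ℤ) : ℤ) := by
      push_cast; linarith
    rw [h1] at hβ0 hβ1
    have h2 : (0 : ℤ) < ((n - 1 - y : ℕ) : ℤ) - (i : ℤ) := by exact_mod_cast hβ0
    have h3 : ((n - 1 - y : ℕ) : ℤ) - (i : ℤ) < 1 := by exact_mod_cast hβ1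
    omega
  have hf : (fun x : ℝ => (((1 + x) ^ y : ℝ) : ℂ)) =
      (fun x : ℝ => (((1 + x) ^ (y : ℝ) : ℝ) : ℂ)) := by
    funext x; rw [Real.rpow_natCast]
  rw [hf]
  have key : Tendsto (sesq α β n (fun x : ℝ => (((1 + x) ^ (y : ℝ) : ℝ) : ℂ))
      (fun x : ℝ => (((1 + x) ^ s : ℝ) : ℂ))) (𝓝[>] (-1 : ℝ))
      (𝓝 (∑ k ∈ Finset.Icc 1 n, ∑ j ∈ Finset.Icc 1 k, (-1 : ℂ) ^ (k + j) *
        ((if k = n then ((fallF s k * fallF (s + β) (k - j) * fallF y (j - 1)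
          * 2 ^ (α + k) : ℝ) : ℂ) else 0) -
        (if k = n then ((fallF y k * fallF (y + β) (k - j) * fallF s (j - 1)
          * 2 ^ (α + k) : ℝ) : ℂ) else 0)))) := by
    unfold sesq
    refine tendsto_finsetSum _ fun k hk => tendsto_finsetSum _ fun j hj => ?_
    rw [Finset.mem_Icc] at hk hj
    refine Tendsto.const_mul _ (Tendsto.sub ?_ ?_)
    · exact term_lim α β n k j hj.1 hj.2 hk.2 y s (by rw [hs]; ring)
    · exact term_lim α β n k j hj.1 hj.2 hk.2 s y (by rw [hs]; ring)
  refine ⟨_, ?_, key⟩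
  rw [Finset.sum_eq_single_of_mem n (Finset.mem_Icc.2 ⟨hn, le_rfl⟩)
    (fun k _ hk => by simp [hk])]
  rw [Finset.sum_eq_single_of_mem (y + 1) (Finset.mem_Icc.2 ⟨by omega, by omega⟩)]
  · simp only [if_true]
    rw [fallF_nat_zero y n (by omega), hsb, show n - (y + 1) = n - 1 - y by omega,
      Nat.add_sub_cancel]
    have h2 : (2 : ℝ) ^ (α + n) ≠ 0 := (Real.rpow_pos_of_pos two_pos _).ne'
    have := mul_ne_zero (mul_ne_zero (mul_ne_zero (fallF_ne s n hs_ne)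
      (fallF_nat_self (n - 1 - y))) (fallF_nat_self y)) h2
    simp only [zero_mul, Complex.ofReal_zero, sub_zero]
    exact mul_ne_zero (pow_ne_zero _ (by norm_num)) (Complex.ofReal_ne_zero.2 this)
  · intro j hj hne
    rw [Finset.mem_Icc] at hj
    simp only [if_true]
    rw [fallF_nat_zero y n (by omega), hsb]
    rcases lt_or_gt_of_ne hne with h | h
    · rw [fallF_nat_zero (n - 1 - y) (n - j) (by omega)]; simp
    · rw [fallF_nat_zero y (j - 1) (by omega)]; simp

lemma sesq_neg (α β : ℝ) (n : ℕ) (f g : ℝ → ℂ) (x : ℝ) :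
    sesq α β n (fun x => f (-x)) (fun x => g (-x)) x = -sesq β α n f g (-x) := by
  have hterm : ∀ (k j : ℕ), 1 ≤ j → j ≤ k → ∀ f g : ℝ → ℂ,
      iteratedDeriv (k - j) (fun y => ((ak α β k y : ℝ) : ℂ) *
        iteratedDeriv k (fun x => g (-x)) y) x * iteratedDeriv (j - 1) (fun x => f (-x)) x =
      -(iteratedDeriv (k - j) (fun y => ((ak β α k y : ℝ) : ℂ) * iteratedDeriv k g y) (-x) *
        iteratedDeriv (j - 1) f (-x)) := by
    intro k j hj hjk f g
    have h1 : (fun y => ((ak α β k y : ℝ) : ℂ) * iteratedDeriv k (fun x => g (-x)) y) =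
        fun y => (-1 : ℂ) ^ k *
          (fun y => ((ak β α k y : ℝ) : ℂ) * iteratedDeriv k g y) (-y) := by
      funext y
      have : ak α β k y = ak β α k (-y) := by
        simp only [ak, sub_neg_eq_add, ← sub_eq_add_neg]; ring
      rw [iteratedDeriv_comp_neg, this, Complex.real_smul]
      push_cast
      ring
    rw [h1, iteratedDeriv_const_mul_field,
      iteratedDeriv_comp_neg (k - j) (fun y => ((ak β α k y : ℝ) : ℂ) * iteratedDeriv k g y),
      iteratedDeriv_comp_neg]
    simp only [Complex.real_smul]
    push_cast
    have h2 : (-1 : ℂ) ^ k * (-1) ^ (k - j) * (-1) ^ (j - 1) = -1 := by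
      rw [← pow_add, ← pow_add]
      exact Odd.neg_one_pow ⟨k - 1, by omega⟩
    linear_combination (iteratedDeriv (k - j) (fun y => ((ak β α k y : ℝ) : ℂ) *
      iteratedDeriv k g y) (-x) * iteratedDeriv (j - 1) f (-x)) * h2
  unfold sesq
  rw [← Finset.sum_neg_distrib]
  refine Finset.sum_congr rfl fun k hk => ?_
  rw [← Finset.sum_neg_distrib]
  refine Finset.sum_congr rfl fun j hj => ?_
  rw [Finset.mem_Icc] at hj
  rw [hterm k j hj.1 hj.2 f g, hterm k j hj.1 hj.2 g f]
  ring

/-- For `0 ≤ y ≤ n-1`, the limit `lim_{x→1⁻} [(1-x)^y, (1-x)^{-α+n-1-y}]_n(x)` exists and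
is a nonzero finite constant, and likewise `lim_{x→-1⁺} [(1+x)^y, (1+x)^{-β+n-1-y}]_n(x)`
exists and is nonzero; hence these endpoint functions are not in the minimal domain. -/
theorem jacobi_defect_functions_not_in_minimal_domain (α β : ℝ)
    (hα0 : 0 < α) (hα1 : α < 1) (hβ0 : 0 < β) (hβ1 : β < 1) (n : ℕ) (hn : 1 ≤ n)
    (y : ℕ) (hy : y ≤ n - 1) :
    (∃ L : ℂ, L ≠ 0 ∧
      Tendsto (sesq α β n (fun x : ℝ => (((1 - x) ^ y : ℝ) : ℂ))
          (fun x : ℝ => (((1 - x) ^ (-α + ((n : ℝ) - 1 - (y : ℝ))) : ℝ) : ℂ)))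
        (𝓝[<] (1 : ℝ)) (𝓝 L)) ∧
    (∃ L : ℂ, L ≠ 0 ∧
      Tendsto (sesq α β n (fun x : ℝ => (((1 + x) ^ y : ℝ) : ℂ))
          (fun x : ℝ => (((1 + x) ^ (-β + ((n : ℝ) - 1 - (y : ℝ))) : ℝ) : ℂ)))
        (𝓝[>] (-1 : ℝ)) (𝓝 L)) := by
  refine ⟨?_, left_side α β hβ0 hβ1 n hn y hy⟩
  obtain ⟨L, hL, hT⟩ := left_side β α hα0 hα1 n hn y hy
  refine ⟨-L, neg_ne_zero.2 hL, ?_⟩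
  have hneg : Tendsto (fun x : ℝ => -x) (𝓝[<] (1 : ℝ)) (𝓝[>] (-1 : ℝ)) :=
    tendsto_neg_nhdsLT
  refine ((hT.comp hneg).neg).congr fun x => ?_
  have h := sesq_neg α β n (fun x : ℝ => (((1 + x) ^ y : ℝ) : ℂ))
    (fun x : ℝ => (((1 + x) ^ (-α + ((n : ℝ) - 1 - (y : ℝ))) : ℝ) : ℂ)) x
  simp only [← sub_eq_add_neg] at h
  rw [h]
  rfl
end

section
/- Fix 0 ≤ α, β < 1 and n ∈ ℕ, and let s, t ∈ ℕ₀ satisfy s ≤ n, t ≤ n and s + t ≥ n. Then lim_{x→1⁻} [ (1-x)^s , (1-x)^{-α+t} ]_n(x) = 0 and lim_{x→-1⁺} [ (1+x)^s , (1+x)^{-β+t} ]_n(x) = 0, where [·,·]_n is the n-th Jacobi sesquilinear form. -/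
open MeasureTheory Set Filter Topology

open scoped ContDiff

/-- The region where the other factor is positive. -/
def sU (σ : ℝ) : Set ℝ := {x | 0 < 1 - σ * x}

/-- The interval `(-1,1)`, written through `σ`. -/
def sV (σ : ℝ) : Set ℝ := {x | 0 < 1 - σ * x ∧ 0 < 1 + σ * x}

/-- `F` is `(1+σx)^c` times a function smooth up to the endpoint. -/
def PowSmooth (σ c : ℝ) (F : ℝ → ℂ) : Prop :=
  ∃ h : ℝ → ℂ, ContDiffOn ℝ ∞ h (sU σ) ∧
    ∀ x ∈ sV σ, F x = (((1 + σ * x) ^ c : ℝ) : ℂ) * h x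

lemma sU_open (σ : ℝ) : IsOpen (sU σ) :=
  isOpen_lt continuous_const (by fun_prop)

lemma sV_open (σ : ℝ) : IsOpen (sV σ) :=
  (isOpen_lt continuous_const (by fun_prop : Continuous fun x : ℝ => 1 - σ * x)).inter
    (isOpen_lt continuous_const (by fun_prop : Continuous fun x : ℝ => 1 + σ * x))

lemma PowSmooth.deriv {σ c : ℝ} {F : ℝ → ℂ} (hF : PowSmooth σ c F) :
    PowSmooth σ (c - 1) (deriv F) := by
  obtain ⟨h, hh, hFh⟩ := hF
  refine ⟨fun x => ((σ * c : ℝ) : ℂ) * h x + ((1 + σ * x : ℝ) : ℂ) * _root_.deriv h x, ?_, ?_⟩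
  · have h1 : ContDiffOn ℝ ∞ (_root_.deriv h) (sU σ) :=
      hh.deriv_of_isOpen (sU_open σ) (by simp)
    have h2 : ContDiffOn ℝ ∞ (fun x : ℝ => ((1 + σ * x : ℝ) : ℂ)) (sU σ) :=
      (Complex.ofRealCLM.contDiff.comp (by fun_prop : ContDiff ℝ ∞ fun x : ℝ => 1 + σ * x)).contDiffOn
    exact (contDiffOn_const.mul hh).add (h2.mul h1)
  · intro x hx
    have hu : 0 < 1 + σ * x := hx.2
    have e : F =ᶠ[𝓝 x] fun y => (((1 + σ * y) ^ c : ℝ) : ℂ) * h y :=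
      Filter.eventually_of_mem ((sV_open σ).mem_nhds hx) hFh
    rw [e.deriv_eq]
    have hd : DifferentiableAt ℝ h x :=
      (hh.contDiffAt ((sU_open σ).mem_nhds hx.1)).differentiableAt (by simp)
    have hl : HasDerivAt (fun y : ℝ => 1 + σ * y) σ x := by
      simpa using ((hasDerivAt_id x).const_mul σ).const_add 1
    have hp := (hl.rpow_const (p := c) (Or.inl hu.ne')).ofReal_comp
    refine (hp.mul hd.hasDerivAt).deriv.trans ?_
    beta_reduce
    have : (1 + σ * x) ^ c = (1 + σ * x) ^ (c - 1) * (1 + σ * x) := by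
      rw [← Real.rpow_add_one hu.ne']; congr 1; ring
    rw [this]
    push_cast
    ring

lemma PowSmooth.iter {σ c : ℝ} {F : ℝ → ℂ} (hF : PowSmooth σ c F) (m : ℕ) :
    PowSmooth σ (c - m) (iteratedDeriv m F) := by
  induction m with
  | zero => simpa using hF
  | succ m ih =>
    rw [iteratedDeriv_succ]
    have := ih.deriv
    convert this using 1
    push_cast; ring

lemma PowSmooth.mul {σ c d : ℝ} {F G : ℝ → ℂ} (hF : PowSmooth σ c F) (hG : PowSmooth σ d G) :
    PowSmooth σ (c + d) (fun x => F x * G x) := by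
  obtain ⟨h, hh, e⟩ := hF
  obtain ⟨k, hk, e'⟩ := hG
  refine ⟨fun x => h x * k x, hh.mul hk, fun x hx => ?_⟩
  simp only [e x hx, e' x hx, Real.rpow_add hx.2]
  push_cast; ring

lemma PowSmooth.tendsto {σ c : ℝ} (hσ : σ * σ = 1) {F : ℝ → ℂ} (hF : PowSmooth σ c F)
    (hc : 0 < c) : Tendsto F (𝓝[sV σ] (-σ)) (𝓝 0) := by
  obtain ⟨h, hh, e⟩ := hF
  have hU : -σ ∈ sU σ := by
    show 0 < 1 - σ * (-σ)
    nlinarith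
  have hcont : ContinuousAt h (-σ) := hh.continuousOn.continuousAt ((sU_open σ).mem_nhds hU)
  have hr : ContinuousAt (fun x : ℝ => (1 + σ * x) ^ c) (-σ) :=
    ContinuousAt.rpow_const (by fun_prop) (Or.inr hc.le)
  have hr' : ContinuousAt (fun x : ℝ => (((1 + σ * x) ^ c : ℝ) : ℂ)) (-σ) :=
    Complex.continuous_ofReal.continuousAt.comp hr
  have ht : Tendsto (fun x : ℝ => (((1 + σ * x) ^ c : ℝ) : ℂ) * h x) (𝓝 (-σ))
      (𝓝 ((((1 + σ * (-σ)) ^ c : ℝ) : ℂ) * h (-σ))) := (hr'.mul hcont).tendsto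
  have z : (1 + σ * (-σ)) = 0 := by linarith
  rw [z, Real.zero_rpow hc.ne', Complex.ofReal_zero, zero_mul] at ht
  refine (ht.mono_left nhdsWithin_le_nhds).congr' ?_
  filter_upwards [self_mem_nhdsWithin] with x hx
  exact (e x hx).symm

lemma PowSmooth.base (σ c d : ℝ) :
    PowSmooth σ c (fun x => (((1 + σ * x) ^ c * (1 - σ * x) ^ d : ℝ) : ℂ)) := by
  refine ⟨fun x => (((1 - σ * x) ^ d : ℝ) : ℂ), ?_, fun x _ => by push_cast; rfl⟩
  have : ContDiffOn ℝ ∞ (fun x : ℝ => (1 - σ * x) ^ d) (sU σ) :=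
    ContDiffOn.rpow_const_of_ne (by fun_prop) (fun x hx => ne_of_gt hx)
  exact Complex.ofRealCLM.contDiff.comp_contDiffOn this

lemma sesq_tendsto (α β σ γ : ℝ) (hσ : σ * σ = 1) (n s t : ℕ) (hst : n ≤ s + t) (f g : ℝ → ℂ)
    (ha : ∀ k : ℕ, PowSmooth σ (γ + k) (fun x => ((ak α β k x : ℝ) : ℂ)))
    (hf : PowSmooth σ s f) (hg : PowSmooth σ (-γ + t) g) :
    Tendsto (sesq α β n f g) (𝓝[sV σ] (-σ)) (𝓝 0) := by
  unfold sesq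
  rw [show (0 : ℂ) = ∑ k ∈ Finset.Icc 1 n, ∑ j ∈ Finset.Icc 1 k, (-1 : ℂ) ^ (k + j) * (0 - 0) by
    simp]
  refine tendsto_finsetSum _ fun k hk => tendsto_finsetSum _ fun j hj => ?_
  rw [Finset.mem_Icc] at hk hj
  have hkn : (k : ℝ) ≤ s + t := by exact_mod_cast hk.2.trans hst
  refine Tendsto.const_mul _ (Tendsto.sub ?_ ?_)
  · refine ((((ha k).mul (hg.iter k)).iter (k - j)).mul (hf.iter (j - 1))).tendsto hσ ?_
    push_cast [Nat.cast_sub hj.2, Nat.cast_sub hj.1]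
    linarith
  · refine ((((ha k).mul (hf.iter k)).iter (k - j)).mul (hg.iter (j - 1))).tendsto hσ ?_
    push_cast [Nat.cast_sub hj.2, Nat.cast_sub hj.1]
    linarith



/-- For `s,t ≤ n` with `s + t ≥ n`, the sesquilinear form `[(1-x)^s, (1-x)^{-α+t}]_n`
vanishes in the limit at `1`, and `[(1+x)^s, (1+x)^{-β+t}]_n` vanishes in the limit
at `-1`. -/
theorem jacobi_sesq_mixed_vanishes (α β : ℝ)
    (hα0 : 0 ≤ α) (hα1 : α < 1) (hβ0 : 0 ≤ β) (hβ1 : β < 1) (n : ℕ) (hn : 1 ≤ n)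
    (s t : ℕ) (hs : s ≤ n) (ht : t ≤ n) (hst : n ≤ s + t) :
    Tendsto (sesq α β n (fun x : ℝ => (((1 - x) ^ s : ℝ) : ℂ))
        (fun x : ℝ => (((1 - x) ^ (-α + (t : ℝ)) : ℝ) : ℂ))) (𝓝[<] (1 : ℝ)) (𝓝 0) ∧
    Tendsto (sesq α β n (fun x : ℝ => (((1 + x) ^ s : ℝ) : ℂ))
        (fun x : ℝ => (((1 + x) ^ (-β + (t : ℝ)) : ℝ) : ℂ))) (𝓝[>] (-1 : ℝ)) (𝓝 0) := by

  constructor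
  · have hV : 𝓝[<] (1 : ℝ) ≤ 𝓝[sV (-1)] (-(-1)) := by
      rw [neg_neg]
      refine nhdsWithin_le_iff.2 ?_
      filter_upwards [Ioo_mem_nhdsLT (show (0 : ℝ) < 1 by norm_num)] with x hx
      exact ⟨by linarith [hx.1], by linarith [hx.2]⟩
    refine Tendsto.mono_left (sesq_tendsto α β (-1) α (by norm_num) n s t hst _ _ ?_ ?_ ?_) hV
    · intro k
      convert PowSmooth.base (-1) (α + k) (β + k) using 4 with x
      unfold ak
      congr 2 <;> ring
    · convert PowSmooth.base (-1) s 0 using 3 with x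
      rw [Real.rpow_zero, mul_one, Real.rpow_natCast]
      congr 1; ring
    · convert PowSmooth.base (-1) (-α + t) 0 using 3 with x
      rw [Real.rpow_zero, mul_one]
      congr 1; ring
  · have hV : 𝓝[>] (-1 : ℝ) ≤ 𝓝[sV 1] (-1) := by
      refine nhdsWithin_le_iff.2 ?_
      filter_upwards [Ioo_mem_nhdsGT (show (-1 : ℝ) < 0 by norm_num)] with x hx
      exact ⟨by linarith [hx.2], by linarith [hx.1]⟩
    refine Tendsto.mono_left (sesq_tendsto α β 1 β (by norm_num) n s t hst _ _ ?_ ?_ ?_) hV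
    · intro k
      convert PowSmooth.base 1 (β + k) (α + k) using 4 with x
      unfold ak
      rw [mul_comm, one_mul]
    · convert PowSmooth.base 1 s 0 using 3 with x
      rw [Real.rpow_zero, mul_one, Real.rpow_natCast, one_mul]
    · convert PowSmooth.base 1 (-β + t) 0 using 3 with x
      rw [Real.rpow_zero, mul_one, one_mul]
end

section
/- Fix 0 ≤ α, β < 1 and n ∈ ℕ, and let s, t ∈ ℕ₀ satisfy s < n and t < n. Then lim_{x→1⁻} [ (1-x)^s , (1-x)^t ]_n(x) = 0 and lim_{x→-1⁺} [ (1+x)^s , (1+x)^t ]_n(x) = 0, where [·,·]_n is the n-th Jacobi sesquilinear form. -/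
open MeasureTheory Set Filter Topology

lemma aux_iter (c e p : ℝ) (k : ℕ) (hp : (k : ℝ) ≤ p) (i : ℕ) (hi : i ≤ k) :
    ∃ C : ℂ, iteratedDeriv i (fun y : ℝ => (((c + e * y) ^ p : ℝ) : ℂ)) =
      fun y : ℝ => C * (((c + e * y) ^ (p - (i : ℝ)) : ℝ) : ℂ) := by
  induction i with
  | zero => exact ⟨1, by simp⟩
  | succ i ih =>
    obtain ⟨C, hC⟩ := ih (by omega)
    have hi' : ((i : ℝ) + 1) ≤ k := by exact_mod_cast hi
    refine ⟨C * ((e * (p - i) : ℝ) : ℂ), ?_⟩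
    rw [iteratedDeriv_succ, hC]
    funext y
    have h1 : HasDerivAt (fun y : ℝ => c + e * y) e y := by
      simpa using ((hasDerivAt_id y).const_mul e).const_add c
    have h2 := h1.rpow_const (p := p - (i : ℝ)) (Or.inr (by linarith))
    have h3 := (h2.ofReal_comp.const_mul C).deriv
    rw [h3]
    have : p - (i : ℝ) - 1 = p - ((i + 1 : ℕ) : ℝ) := by push_cast; ring
    rw [this]
    push_cast
    ring

lemma aux_smooth (c e p : ℝ) (k : ℕ) (hp : (k : ℝ) ≤ p) :
    ContDiff ℝ k (fun y : ℝ => (((c + e * y) ^ p : ℝ) : ℂ)) := by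
  have h1 : ContDiff ℝ k (fun y : ℝ => c + e * y) := by fun_prop
  exact Complex.ofRealCLM.contDiff.comp ((Real.contDiff_rpow_const_of_le hp).comp h1)

lemma aux_key (c e p x0 : ℝ) (k m : ℕ) (hm : m < k) (hp : (k : ℝ) ≤ p) (h0 : c + e * x0 = 0)
    (H : ℝ → ℂ) (hH : ContDiff ℝ k H) :
    Tendsto (iteratedDeriv m (fun y : ℝ => (((c + e * y) ^ p : ℝ) : ℂ) * H y)) (𝓝 x0) (𝓝 0) := by
  have hF := aux_smooth c e p k hp
  have hmk : ((m : ℕ) : WithTop ℕ∞) ≤ (k : WithTop ℕ∞) := by exact_mod_cast hm.le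
  have hc : Continuous (iteratedDeriv m (fun y : ℝ => (((c + e * y) ^ p : ℝ) : ℂ) * H y)) :=
    (hF.mul hH).continuous_iteratedDeriv m hmk
  have hv : iteratedDeriv m (fun y : ℝ => (((c + e * y) ^ p : ℝ) : ℂ) * H y) x0 = 0 := by
    have := iteratedDeriv_fun_mul (n := m) (x := x0) ((hF.of_le hmk).contDiffAt)
      ((hH.of_le hmk).contDiffAt)
    rw [this]
    refine Finset.sum_eq_zero fun i hi => ?_
    have him : i < k := by
      have := Finset.mem_range.1 hi
      omega
    obtain ⟨C, hC⟩ := aux_iter c e p k hp i him.le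
    have : (i : ℝ) < k := by exact_mod_cast him
    rw [hC]
    beta_reduce
    rw [h0, Real.zero_rpow (by linarith)]
    simp
  have := hc.tendsto x0
  rwa [hv] at this

lemma aux_sesq (α β : ℝ) (n : ℕ) (x0 : ℝ) (f g : ℝ → ℂ)
    (hf : ∀ k : ℕ, ContDiff ℝ k f) (hg : ∀ k : ℕ, ContDiff ℝ k g)
    (hA : ∀ (k m : ℕ) (H : ℝ → ℂ), m < k → ContDiff ℝ k H →
      Tendsto (iteratedDeriv m (fun y => ((ak α β k y : ℝ) : ℂ) * H y)) (𝓝 x0) (𝓝 0)) :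
    Tendsto (sesq α β n f g) (𝓝 x0) (𝓝 0) := by
  have hD : ∀ (u : ℝ → ℂ), (∀ k : ℕ, ContDiff ℝ k u) → ∀ k : ℕ,
      ContDiff ℝ k (iteratedDeriv k u) := by
    intro u hu k
    have := hu (k + k)
    exact ContDiff.iterate_deriv' k k (by exact_mod_cast this) |> fun h => by
      rwa [← iteratedDeriv_eq_iterate] at h
  have hC : ∀ (u : ℝ → ℂ), (∀ k : ℕ, ContDiff ℝ k u) → ∀ k : ℕ,
      Tendsto (iteratedDeriv k u) (𝓝 x0) (𝓝 (iteratedDeriv k u x0)) :=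
    fun u hu k => (hD u hu k).continuous.tendsto x0
  have : Tendsto (sesq α β n f g) (𝓝 x0)
      (𝓝 (∑ k ∈ Finset.Icc 1 n, ∑ j ∈ Finset.Icc 1 k, (0 : ℂ))) := by
    unfold sesq
    refine tendsto_finsetSum _ fun k hk => tendsto_finsetSum _ fun j hj => ?_
    rw [Finset.mem_Icc] at hj
    have h1 := (hA k (k - j) _ (by omega) (hD g hg k)).mul (hC f hf (j - 1))
    have h2 := (hA k (k - j) _ (by omega) (hD f hf k)).mul (hC g hg (j - 1))
    simpa using (h1.sub h2).const_mul ((-1 : ℂ) ^ (k + j))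
  simpa using this

/-- For `s,t < n`, the sesquilinear form `[(1-x)^s, (1-x)^t]_n` vanishes in the limit at
`1`, and `[(1+x)^s, (1+x)^t]_n` vanishes in the limit at `-1`. -/
theorem jacobi_sesq_first_kind_vanishes (α β : ℝ)
    (hα0 : 0 ≤ α) (hα1 : α < 1) (hβ0 : 0 ≤ β) (hβ1 : β < 1) (n : ℕ) (hn : 1 ≤ n)
    (s t : ℕ) (hs : s < n) (ht : t < n) :
    Tendsto (sesq α β n (fun x : ℝ => (((1 - x) ^ s : ℝ) : ℂ))
        (fun x : ℝ => (((1 - x) ^ t : ℝ) : ℂ))) (𝓝[<] (1 : ℝ)) (𝓝 0) ∧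
    Tendsto (sesq α β n (fun x : ℝ => (((1 + x) ^ s : ℝ) : ℂ))
        (fun x : ℝ => (((1 + x) ^ t : ℝ) : ℂ))) (𝓝[>] (-1 : ℝ)) (𝓝 0) := by
  have sm : ∀ (c e : ℝ) (s k : ℕ), ContDiff ℝ k (fun x : ℝ => (((c + e * x) ^ s : ℝ) : ℂ)) := by
    intro c e s k
    have h1 : ContDiff ℝ k (fun x : ℝ => (c + e * x) ^ s) := by fun_prop
    exact Complex.ofRealCLM.contDiff.comp h1
  have sm1 : ∀ s k : ℕ, ContDiff ℝ k (fun x : ℝ => (((1 - x) ^ s : ℝ) : ℂ)) := by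
    intro s k
    have h := sm 1 (-1) s k
    simp only [neg_one_mul, ← sub_eq_add_neg] at h
    exact h
  have sm2 : ∀ s k : ℕ, ContDiff ℝ k (fun x : ℝ => (((1 + x) ^ s : ℝ) : ℂ)) := by
    intro s k
    have h := sm 1 1 s k
    simp only [one_mul] at h
    exact h
  constructor
  · refine (aux_sesq α β n 1 _ _ (sm1 s) (sm1 t) ?_).mono_left nhdsWithin_le_nhds
    intro k m H hm hH
    have h := aux_key 1 (-1) (α + k) 1 k m hm (by linarith) (by norm_num) _
      ((aux_smooth 1 1 (β + k) k (by linarith)).mul hH)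
    convert h using 3 with y
    simp only [ak, neg_one_mul, ← sub_eq_add_neg, one_mul]
    push_cast
    ring
  · refine (aux_sesq α β n (-1) _ _ (sm2 s) (sm2 t) ?_).mono_left nhdsWithin_le_nhds
    intro k m H hm hH
    have h := aux_key 1 1 (β + k) (-1) k m hm (by linarith) (by norm_num) _
      ((aux_smooth 1 (-1) (α + k) k (by linarith)).mul hH)
    convert h using 3 with y
    simp only [ak, neg_one_mul, ← sub_eq_add_neg, one_mul]
    push_cast
    ring
end

section
/- Fix 0 < α, β < 1 and n ∈ ℕ. Let c_0, …, c_{n-1} ∈ ℂ and set p = Σ_{m=0}^{n-1} c_m·P_m^{(α,β)}, where P_m^{(α,β)} is the m-th Jacobi polynomial. If for every f in the maximal domain D_max^{J,n} the one-sided limits lim_{x→1⁻}[f,p]_n(x) and lim_{x→-1⁺}[f,p]_n(x) exist and are equal (i.e. [f,p]_n evaluated from -1 to 1 vanishes), then c_m = 0 for all m. (That is, the Jacobi polynomials P_0^{(α,β)}, …, P_{n-1}^{(α,β)} are linearly independent modulo the minimal domain of the n-th power of the Jacobi expression.) -/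
open MeasureTheory Set Filter Topology

/-- The `n`-th Jacobi sesquilinear form with conjugation on the second argument. -/
noncomputable def sesqC (α β : ℝ) (n : ℕ) (f g : ℝ → ℂ) (x : ℝ) : ℂ :=
  ∑ k ∈ Finset.Icc 1 n, ∑ j ∈ Finset.Icc 1 k, (-1 : ℂ) ^ (k + j) *
    (iteratedDeriv (k - j)
        (fun y => ((ak α β k y : ℝ) : ℂ) *
          iteratedDeriv k (fun z => (starRingEnd ℂ) (g z)) y) x *
        iteratedDeriv (j - 1) f x -
      iteratedDeriv (k - j) (fun y => ((ak α β k y : ℝ) : ℂ) * iteratedDeriv k f y) x *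
        iteratedDeriv (j - 1) (fun z => (starRingEnd ℂ) (g z)) x)

/-- The rising Pochhammer symbol `(a)_r = a(a+1)⋯(a+r-1)`. -/
noncomputable def poch (a : ℝ) (r : ℕ) : ℝ := ∏ i ∈ Finset.range r, (a + i)

/-- The `m`-th Jacobi polynomial
`P_m^{(α,β)}(x) = Σ_{j=0}^{m} (-1/2)^j ((m+α+β+1)_j (α+j+1)_{m-j}) / (j!(m-j)!) (1-x)^j`. -/
noncomputable def jacobiP (α β : ℝ) (m : ℕ) (x : ℝ) : ℝ :=
  ∑ j ∈ Finset.range (m + 1),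
    (-(1 : ℝ) / 2) ^ j *
      (poch ((m : ℝ) + α + β + 1) j * poch (α + (j : ℝ) + 1) (m - j)) /
      ((j.factorial : ℝ) * ((m - j).factorial : ℝ)) * (1 - x) ^ j

open Polynomial in
/-- The model functions `(1-x)^a (1+x)^b Q(x)`. -/
noncomputable def jW (a b : ℝ) (Q : Polynomial ℂ) (x : ℝ) : ℂ :=
  (((1 - x) ^ a * (1 + x) ^ b : ℝ) : ℂ) * Q.eval (x : ℂ)

lemma jW_mul {a b c d : ℝ} {Q R : Polynomial ℂ} {x : ℝ} (hx : x ∈ Ioo (-1 : ℝ) 1) :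
    jW a b Q x * jW c d R x = jW (a + c) (b + d) (Q * R) x := by
  have h1 : 0 < 1 - x := by linarith [hx.2]
  have h2 : 0 < 1 + x := by linarith [hx.1]
  simp only [jW, Real.rpow_add h1, Real.rpow_add h2, Polynomial.eval_mul]
  push_cast
  ring

lemma jW_hasDerivAt (a b : ℝ) (Q : Polynomial ℂ) {x : ℝ} (hx : x ∈ Ioo (-1 : ℝ) 1) :
    HasDerivAt (jW a b Q) (jW (a - 1) (b - 1)
      (-(Polynomial.C (a : ℂ)) * (1 + Polynomial.X) * Q
        + Polynomial.C (b : ℂ) * (1 - Polynomial.X) * Q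
        + (1 - Polynomial.X) * (1 + Polynomial.X) * Polynomial.derivative Q) x) x := by
  have h1 : 0 < 1 - x := by linarith [hx.2]
  have h2 : 0 < 1 + x := by linarith [hx.1]
  have e1 : HasDerivAt (fun y : ℝ => (1 - y) ^ a) (-1 * a * (1 - x) ^ (a - 1)) x :=
    ((hasDerivAt_id x).const_sub 1).rpow_const (Or.inl h1.ne')
  have e2 : HasDerivAt (fun y : ℝ => (1 + y) ^ b) (1 * b * (1 + x) ^ (b - 1)) x :=
    ((hasDerivAt_id x).const_add 1).rpow_const (Or.inl h2.ne')
  have e3 := (Q.hasDerivAt (x : ℂ)).comp_ofReal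
  have e4 := ((e1.mul e2).ofReal_comp).mul e3
  refine e4.congr_deriv ?_
  have r1 : (1 - x) ^ a = (1 - x) ^ (a - 1) * (1 - x) := by
    rw [← Real.rpow_add_one h1.ne']; ring_nf
  have r2 : (1 + x) ^ b = (1 + x) ^ (b - 1) * (1 + x) := by
    rw [← Real.rpow_add_one h2.ne']; ring_nf
  simp only [jW, Pi.mul_apply, r1, r2]
  simp
  ring

lemma jW_shift1 {a b : ℝ} {Q : Polynomial ℂ} {x : ℝ} (hx : x ∈ Ioo (-1 : ℝ) 1) :
    jW (a - 1) b ((1 - Polynomial.X) * Q) x = jW a b Q x := by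
  have h1 : 0 < 1 - x := by linarith [hx.2]
  have r1 : (1 - x) ^ a = (1 - x) ^ (a - 1) * (1 - x) := by
    rw [← Real.rpow_add_one h1.ne']; ring_nf
  simp only [jW, r1]
  simp
  ring

lemma jW_shift2 {a b : ℝ} {Q : Polynomial ℂ} {x : ℝ} (hx : x ∈ Ioo (-1 : ℝ) 1) :
    jW a (b - 1) ((1 + Polynomial.X) * Q) x = jW a b Q x := by
  have h1 : 0 < 1 + x := by linarith [hx.1]
  have r1 : (1 + x) ^ b = (1 + x) ^ (b - 1) * (1 + x) := by
    rw [← Real.rpow_add_one h1.ne']; ring_nf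
  simp only [jW, r1]
  simp
  ring

lemma jW_hasDerivAt_left (a : ℝ) (Q : Polynomial ℂ) {x : ℝ} (hx : x ∈ Ioo (-1 : ℝ) 1) :
    HasDerivAt (jW a 0 Q) (jW (a - 1) 0
      (-(Polynomial.C (a : ℂ)) * Q + (1 - Polynomial.X) * Polynomial.derivative Q) x) x := by
  refine (jW_hasDerivAt a 0 Q hx).congr_deriv ?_
  rw [← jW_shift2 hx (b := 0)]
  congr 1
  simp
  ring

lemma jW_hasDerivAt_right (b : ℝ) (Q : Polynomial ℂ) {x : ℝ} (hx : x ∈ Ioo (-1 : ℝ) 1) :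
    HasDerivAt (jW 0 b Q) (jW 0 (b - 1)
      (Polynomial.C (b : ℂ) * Q + (1 + Polynomial.X) * Polynomial.derivative Q) x) x := by
  refine (jW_hasDerivAt 0 b Q hx).congr_deriv ?_
  rw [← jW_shift1 hx (a := 0)]
  congr 1
  simp
  ring

lemma deriv_of_eqOn {f F F' : ℝ → ℂ} (h : EqOn f F (Ioo (-1 : ℝ) 1))
    (hF : ∀ x ∈ Ioo (-1 : ℝ) 1, HasDerivAt F (F' x) x) :
    EqOn (deriv f) F' (Ioo (-1 : ℝ) 1) := by
  intro x hx
  have : f =ᶠ[𝓝 x] F := h.eventuallyEq_of_mem (isOpen_Ioo.mem_nhds hx)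
  rw [this.deriv_eq, (hF x hx).deriv]

lemma iter_gen {f : ℝ → ℂ} {a b : ℝ} {Q : Polynomial ℂ}
    (h : EqOn f (jW a b Q) (Ioo (-1 : ℝ) 1)) (m : ℕ) :
    ∃ R, EqOn (iteratedDeriv m f) (jW (a - m) (b - m) R) (Ioo (-1 : ℝ) 1) := by
  induction m with
  | zero => exact ⟨Q, by simpa using h⟩
  | succ m ih =>
    obtain ⟨R, hR⟩ := ih
    have := deriv_of_eqOn hR (fun x hx => jW_hasDerivAt _ _ R hx)
    rw [iteratedDeriv_succ]
    push_cast
    rw [← sub_sub, ← sub_sub]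
    exact ⟨_, this⟩

lemma iter_right {f : ℝ → ℂ} {b : ℝ} {Q : Polynomial ℂ}
    (h : EqOn f (jW 0 b Q) (Ioo (-1 : ℝ) 1)) (m : ℕ) :
    ∃ R, EqOn (iteratedDeriv m f) (jW 0 (b - m) R) (Ioo (-1 : ℝ) 1) := by
  induction m with
  | zero => exact ⟨Q, by simpa using h⟩
  | succ m ih =>
    obtain ⟨R, hR⟩ := ih
    have := deriv_of_eqOn hR (fun x hx => jW_hasDerivAt_right _ R hx)
    rw [iteratedDeriv_succ]
    push_cast
    rw [← sub_sub]
    exact ⟨_, this⟩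

lemma iter_left {f : ℝ → ℂ} {a : ℝ} {i : ℕ} {u : ℂ} (hu : u ≠ 0)
    (ha : ∀ m : ℕ, a - m + i ≠ 0)
    (h : EqOn f (jW a 0 (Polynomial.C u * (1 - Polynomial.X) ^ i)) (Ioo (-1 : ℝ) 1)) (m : ℕ) :
    ∃ v : ℂ, v ≠ 0 ∧ EqOn (iteratedDeriv m f)
      (jW (a - m) 0 (Polynomial.C v * (1 - Polynomial.X) ^ i)) (Ioo (-1 : ℝ) 1) := by
  induction m with
  | zero => exact ⟨u, hu, by simpa using h⟩
  | succ m ih =>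
    obtain ⟨v, hv, hR⟩ := ih
    refine ⟨-((a - m + i : ℝ) : ℂ) * v, ?_, ?_⟩
    · exact mul_ne_zero (neg_ne_zero.2 (by exact_mod_cast ha m)) hv
    · rw [iteratedDeriv_succ]
      have := deriv_of_eqOn hR (fun x hx => jW_hasDerivAt_left _ _ hx)
      push_cast
      rw [← sub_sub]
      intro x hx
      rw [this hx]
      simp only [jW]
      congr 1
      rcases i with _ | i
      · simp
      · simp [Polynomial.derivative_pow]
        ring

lemma iter_right_zero {f : ℝ → ℂ} {b : ℝ} {i : ℕ} {U : Polynomial ℂ} (hU : U.eval 1 ≠ 0)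
    (h : EqOn f (jW 0 b ((1 - Polynomial.X) ^ i * U)) (Ioo (-1 : ℝ) 1)) (m : ℕ) (hm : m ≤ i) :
    ∃ V : Polynomial ℂ, V.eval 1 ≠ 0 ∧ EqOn (iteratedDeriv m f)
      (jW 0 (b - m) ((1 - Polynomial.X) ^ (i - m) * V)) (Ioo (-1 : ℝ) 1) := by
  induction m with
  | zero => exact ⟨U, hU, by simpa using h⟩
  | succ m ih =>
    obtain ⟨V, hV, hR⟩ := ih (by omega)
    obtain ⟨r, hr⟩ : ∃ r, i - m = r + 1 := ⟨i - m - 1, by omega⟩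
    have hr' : i - (m + 1) = r := by omega
    rw [hr] at hR
    rw [hr']
    refine ⟨Polynomial.C ((b - m : ℝ) : ℂ) * (1 - Polynomial.X) * V
      - Polynomial.C ((r : ℂ) + 1) * (1 + Polynomial.X) * V
      + (1 + Polynomial.X) * (1 - Polynomial.X) * Polynomial.derivative V, ?_, ?_⟩
    · have : (r : ℂ) + 1 ≠ 0 := by exact_mod_cast Nat.succ_ne_zero r
      have h2 : (1 : ℂ) + 1 ≠ 0 := by norm_num
      simp [hV, this, h2]
    · rw [iteratedDeriv_succ]
      have := deriv_of_eqOn hR (fun x hx => jW_hasDerivAt_right _ _ hx)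
      push_cast
      rw [← sub_sub]
      intro x hx
      rw [this hx]
      simp only [jW]
      congr 1
      simp [Polynomial.derivative_pow]
      ring

lemma jW_tendsto_one {f : ℝ → ℂ} {a b : ℝ} {Q : Polynomial ℂ} (ha : 0 ≤ a)
    (h : EqOn f (jW a b Q) (Ioo (-1 : ℝ) 1)) :
    Tendsto f (𝓝[<] (1 : ℝ)) (𝓝 (jW a b Q 1)) := by
  have hc : ContinuousAt (jW a b Q) 1 := by
    unfold jW
    have e1 : ContinuousAt (fun y : ℝ => (1 - y) ^ a) 1 :=
      ContinuousAt.rpow_const (by fun_prop) (Or.inr ha)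
    have e2 : ContinuousAt (fun y : ℝ => (1 + y) ^ b) 1 :=
      ContinuousAt.rpow_const (by fun_prop) (Or.inl (by norm_num))
    have e3 : ContinuousAt (fun y : ℝ => Q.eval (y : ℂ)) 1 := by fun_prop
    exact (Complex.continuous_ofReal.continuousAt.comp (e1.mul e2)).mul e3
  have ht : Tendsto (jW a b Q) (𝓝[<] (1 : ℝ)) (𝓝 (jW a b Q 1)) :=
    hc.tendsto.mono_left nhdsWithin_le_nhds
  refine ht.congr' ?_
  filter_upwards [Ioo_mem_nhdsLT (show (-1 : ℝ) < 1 by norm_num)] with x hx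
  exact (h hx).symm

lemma jW_tendsto_neg_one {f : ℝ → ℂ} {a b : ℝ} {Q : Polynomial ℂ} (hb : 0 < b)
    (h : EqOn f (jW a b Q) (Ioo (-1 : ℝ) 1)) :
    Tendsto f (𝓝[>] (-1 : ℝ)) (𝓝 0) := by
  have hc : ContinuousAt (jW a b Q) (-1) := by
    unfold jW
    have e1 : ContinuousAt (fun y : ℝ => (1 - y) ^ a) (-1) :=
      ContinuousAt.rpow_const (by fun_prop) (Or.inl (by norm_num))
    have e2 : ContinuousAt (fun y : ℝ => (1 + y) ^ b) (-1) :=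
      ContinuousAt.rpow_const (by fun_prop) (Or.inr hb.le)
    have e3 : ContinuousAt (fun y : ℝ => Q.eval (y : ℂ)) (-1) := by fun_prop
    exact (Complex.continuous_ofReal.continuousAt.comp (e1.mul e2)).mul e3
  have hz : jW a b Q (-1) = 0 := by
    simp [jW, Real.zero_rpow hb.ne']
  have ht : Tendsto (jW a b Q) (𝓝[>] (-1 : ℝ)) (𝓝 0) :=
    hz ▸ hc.tendsto.mono_left nhdsWithin_le_nhds
  refine ht.congr' ?_
  filter_upwards [Ioo_mem_nhdsGT (show (-1 : ℝ) < 1 by norm_num)] with x hx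
  exact (h hx).symm

lemma jacobiL_closed (α β : ℝ) {f : ℝ → ℂ} {Q : Polynomial ℂ}
    (h : EqOn f (jW (-α) 0 Q) (Ioo (-1 : ℝ) 1)) :
    ∃ R, EqOn (jacobiL α β f) (jW (-α) 0 R) (Ioo (-1 : ℝ) 1) := by
  have h1 := deriv_of_eqOn h (fun x hx => jW_hasDerivAt_left _ Q hx)
  set R := (-(Polynomial.C ((-α : ℝ) : ℂ)) * Q
    + (1 - Polynomial.X) * Polynomial.derivative Q) with hR
  have h2 : EqOn (fun y : ℝ => (((1 - y) ^ (α + 1) * (1 + y) ^ (β + 1) : ℝ) : ℂ) * deriv f y)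
      (jW 0 (β + 1) R) (Ioo (-1 : ℝ) 1) := by
    intro x hx
    have := jW_mul (a := α + 1) (b := β + 1) (c := -α - 1) (d := 0) (Q := 1) (R := R) hx
    simp only [h1 hx]
    rw [show α + 1 + (-α - 1) = 0 by ring, add_zero, one_mul] at this
    rw [← this]
    simp [jW]
  have h3 := deriv_of_eqOn h2 (fun x hx => jW_hasDerivAt_right _ R hx)
  refine ⟨-(Polynomial.C ((β + 1 : ℝ) : ℂ) * R
    + (1 + Polynomial.X) * Polynomial.derivative R), ?_⟩
  intro x hx
  simp only [jacobiL]
  rw [h3 hx]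
  set S := (Polynomial.C ((β + 1 : ℝ) : ℂ) * R
    + (1 + Polynomial.X) * Polynomial.derivative R)
  have := jW_mul (a := -α) (b := -β) (c := 0) (d := β + 1 - 1) (Q := 1) (R := S) hx
  rw [add_zero, one_mul, show -β + (β + 1 - 1) = 0 by ring] at this
  have h4 : jW (-α) 0 (-S) x = - jW (-α) 0 S x := by simp [jW]
  rw [h4, ← this]
  simp [jW]

lemma jacobiL_iter_closed (α β : ℝ) {f : ℝ → ℂ} {Q : Polynomial ℂ}
    (h : EqOn f (jW (-α) 0 Q) (Ioo (-1 : ℝ) 1)) (n : ℕ) :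
    ∃ R, EqOn ((jacobiL α β)^[n] f) (jW (-α) 0 R) (Ioo (-1 : ℝ) 1) := by
  induction n with
  | zero => exact ⟨Q, h⟩
  | succ n ih =>
    obtain ⟨R, hR⟩ := ih
    rw [Function.iterate_succ_apply']
    exact jacobiL_closed α β hR

lemma memL2_jW {α β : ℝ} (hα1 : α < 1) (hβ0 : 0 < β) {f : ℝ → ℂ}
    {Q : Polynomial ℂ} (h : EqOn f (jW (-α) 0 Q) (Ioo (-1 : ℝ) 1)) : MemL2ab α β f := by
  unfold MemL2ab
  have hI : IntegrableOn (fun x : ℝ => (1 - x) ^ (-α)) (Icc (-1 : ℝ) 1) := by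
    have h0 : IntervalIntegrable (fun x : ℝ => x ^ (-α)) volume 0 2 :=
      intervalIntegral.intervalIntegrable_rpow' (by linarith)
    have h1 := (h0.comp_sub_left 1).symm
    norm_num at h1
    rw [intervalIntegrable_iff_integrableOn_Icc_of_le (by norm_num)] at h1
    exact h1
  have hC : ContinuousOn (fun x : ℝ => ‖Q.eval (x : ℂ)‖ ^ 2 * (1 + x) ^ β) (Icc (-1 : ℝ) 1) := by
    refine ContinuousOn.mul (by fun_prop) ?_
    exact ContinuousOn.rpow_const (by fun_prop) (fun x _ => Or.inr hβ0.le)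
  have hM := (hI.mul_continuousOn hC isCompact_Icc).mono_set (Ioo_subset_Icc_self)
  refine hM.congr_fun ?_ measurableSet_Ioo
  intro x hx
  have h1 : 0 < 1 - x := by linarith [hx.2]
  have key : (1 - x) ^ (-α) * (1 - x) ^ α = 1 := by
    rw [← Real.rpow_add h1]; simp
  simp only [h hx, jW]
  rw [norm_mul, Complex.norm_real, mul_pow, Real.norm_eq_abs, sq_abs]
  simp only [Real.rpow_zero, mul_one]
  linear_combination (-(1 - x) ^ (-α) * ‖Q.eval (x : ℂ)‖ ^ 2 * (1 + x) ^ β) * key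

lemma maxDom_jW {α β : ℝ} (hα1 : α < 1) (hβ0 : 0 < β) (n : ℕ) (Q : Polynomial ℂ) :
    JacobiMaxDom α β n (jW (-α) 0 Q) := by
  refine ⟨?_, memL2_jW hα1 hβ0 (fun _ _ => rfl), ?_⟩
  · unfold jW
    have e1 : ContDiffOn ℝ (2 * n) (fun y : ℝ => (1 - y) ^ (-α) * (1 + y) ^ (0 : ℝ))
        (Ioo (-1 : ℝ) 1) := by
      simp only [Real.rpow_zero, mul_one]
      exact ContDiffOn.rpow_const_of_ne (by fun_prop) (fun x hx => by linarith [hx.2])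
    have e2 : ContDiff ℝ (2 * n) (fun y : ℝ => Q.eval (y : ℂ)) := by
      have h1 : ContDiff ℂ (2 * n) (fun z : ℂ => Q.eval z) := by
        simpa using (Polynomial.contDiff_aeval (𝕜 := ℂ) Q (2 * n))
      exact (h1.restrict_scalars ℝ).comp Complex.ofRealCLM.contDiff
    exact (Complex.ofRealCLM.contDiff.comp_contDiffOn e1).mul e2.contDiffOn
  · obtain ⟨R, hR⟩ := jacobiL_iter_closed α β (f := jW (-α) 0 Q) (fun _ _ => rfl) n
    exact memL2_jW hα1 hβ0 hR

lemma iter_poly (G : Polynomial ℂ) (m : ℕ) :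
    iteratedDeriv m (fun x : ℝ => G.eval (x : ℂ))
      = fun x : ℝ => (Polynomial.derivative^[m] G).eval (x : ℂ) := by
  induction m with
  | zero => simp
  | succ m ih =>
    rw [iteratedDeriv_succ, ih]
    funext x
    rw [((Polynomial.derivative^[m] G).hasDerivAt (x : ℂ)).comp_ofReal.deriv,
      Function.iterate_succ_apply']

lemma poly_eq_jW (G : Polynomial ℂ) : (fun x : ℝ => G.eval (x : ℂ)) = jW 0 0 G := by
  funext x; simp [jW]

/-- limits of the summands -/
lemma term_limits {α β : ℝ} (hα0 : 0 < α) (hα1 : α < 1) (hβ0 : 0 < β) (i : ℕ) (k j : ℕ)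
    (hj : 1 ≤ j) (hjk : j ≤ k) :
    ∃ D : ℂ, (k - j < i → D = 0) ∧ (k - j = i → D ≠ 0) ∧ ∀ (G : Polynomial ℂ),
      let f := jW (-α) 0 ((1 - Polynomial.X) ^ i)
      let g := fun x : ℝ => G.eval (x : ℂ)
      let T := fun x => (iteratedDeriv (k - j)
          (fun y => ((ak α β k y : ℝ) : ℂ) * iteratedDeriv k g y) x * iteratedDeriv (j - 1) f x -
        iteratedDeriv (k - j) (fun y => ((ak α β k y : ℝ) : ℂ) * iteratedDeriv k f y) x *
        iteratedDeriv (j - 1) g x)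
      Tendsto T (𝓝[<] (1 : ℝ)) (𝓝 (-(D * (Polynomial.derivative^[j - 1] G).eval 1))) ∧
      Tendsto T (𝓝[>] (-1 : ℝ)) (𝓝 0) := by
  have hakW : ∀ y, ((ak α β k y : ℝ) : ℂ) = jW (α + k) (β + k) 1 y := by
    intro y; simp [ak, jW]
  have hne : ∀ m : ℕ, -α - m + i ≠ 0 := by
    intro m hm
    have h1 : α = ((i - m : ℤ) : ℝ) := by push_cast; linarith
    rw [h1] at hα0 hα1
    have h2 : (0 : ℤ) < i - m := by exact_mod_cast hα0
    have h3 : (i - m : ℤ) < 1 := by exact_mod_cast hα1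
    omega
  have hf : EqOn (jW (-α) 0 ((1 - Polynomial.X) ^ i))
    (jW (-α) 0 (Polynomial.C 1 * (1 - Polynomial.X) ^ i)) (Ioo (-1 : ℝ) 1) := by
    intro x _; simp
  obtain ⟨v, hv, hfk⟩ := iter_left one_ne_zero hne hf k
  obtain ⟨w, hw, hfj⟩ := iter_left one_ne_zero hne hf (j - 1)
  set f := jW (-α) 0 ((1 - Polynomial.X) ^ i) with hfdef
  have hkj : ((k - j : ℕ) : ℝ) = k - j := by push_cast [hjk]; ring
  have hj1 : ((j - 1 : ℕ) : ℝ) = j - 1 := by push_cast [hj]; ring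
  have hB0 : EqOn (fun y => ((ak α β k y : ℝ) : ℂ) * iteratedDeriv k f y)
      (jW 0 (β + k) ((1 - Polynomial.X) ^ i * Polynomial.C v)) (Ioo (-1 : ℝ) 1) := by
    intro x hx
    simp only [hakW, hfk hx]
    rw [jW_mul hx, show α + k + (-α - k) = 0 by ring, add_zero, one_mul, mul_comm]
  -- a good representation of the B factor
  have hB : ∃ R : Polynomial ℂ, (k - j < i → R.eval 1 = 0) ∧ (k - j = i → R.eval 1 ≠ 0) ∧
      EqOn (iteratedDeriv (k - j) (fun y => ((ak α β k y : ℝ) : ℂ) * iteratedDeriv k f y))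
        (jW 0 (β + j) R) (Ioo (-1 : ℝ) 1) := by
    have hβ : β + k - ((k - j : ℕ) : ℝ) = β + j := by rw [hkj]; ring
    by_cases hle : k - j ≤ i
    · obtain ⟨V, hV, hE⟩ := iter_right_zero (by simpa using hv) hB0 (k - j) hle
      refine ⟨_, ?_, ?_, hβ ▸ hE⟩
      · intro hlt
        have : i - (k - j) ≠ 0 := by omega
        simp [this]
      · intro he
        simp [he] at hV ⊢
        exact hV
    · obtain ⟨R, hE⟩ := iter_right hB0 (k - j)
      exact ⟨R, fun h => absurd h.le hle, fun h => absurd h.le hle, hβ ▸ hE⟩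
  obtain ⟨R, hR1, hR2, hRE⟩ := hB
  have hjpos : (0 : ℝ) < j := by exact_mod_cast hj
  refine ⟨(((1 + 1 : ℝ) ^ (β + j) : ℝ) : ℂ) * R.eval 1, ?_, ?_, ?_⟩
  · intro h; rw [hR1 h, mul_zero]
  · intro h
    refine mul_ne_zero ?_ (hR2 h)
    exact_mod_cast (Real.rpow_pos_of_pos (by norm_num) _).ne'
  intro G f' g T
  have hgk : ∀ m, iteratedDeriv m g = jW 0 0 (Polynomial.derivative^[m] G) := by
    intro m; rw [iter_poly, poly_eq_jW]
  have hA0 : EqOn (fun y => ((ak α β k y : ℝ) : ℂ) * iteratedDeriv k g y)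
      (jW (α + k) (β + k) (Polynomial.derivative^[k] G)) (Ioo (-1 : ℝ) 1) := by
    intro x hx
    simp only [hakW, hgk]
    rw [jW_mul hx, add_zero, add_zero, one_mul]
  obtain ⟨S, hS⟩ := iter_gen hA0 (k - j)
  have hA : EqOn (fun x => iteratedDeriv (k - j)
      (fun y => ((ak α β k y : ℝ) : ℂ) * iteratedDeriv k g y) x * iteratedDeriv (j - 1) f x)
      (jW 1 (β + j) (S * (Polynomial.C w * (1 - Polynomial.X) ^ i))) (Ioo (-1 : ℝ) 1) := by
    intro x hx
    simp only [hS hx, hfj hx]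
    rw [jW_mul hx, hkj, hj1]
    congr 1 <;> ring
  have hBB : EqOn (fun x =>
      iteratedDeriv (k - j) (fun y => ((ak α β k y : ℝ) : ℂ) * iteratedDeriv k f y) x *
        iteratedDeriv (j - 1) g x)
      (jW 0 (β + j) (R * Polynomial.derivative^[j - 1] G)) (Ioo (-1 : ℝ) 1) := by
    intro x hx
    simp only [hRE hx, hgk]
    rw [jW_mul hx, add_zero, add_zero]
  constructor
  · have := (jW_tendsto_one (by norm_num) hA).sub (jW_tendsto_one le_rfl hBB)
    convert this using 2
    simp [jW]
    ring
  · have := (jW_tendsto_neg_one (by linarith) hA).sub (jW_tendsto_neg_one (by linarith) hBB)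
    rw [sub_zero] at this
    exact this

/-- The Jacobi polynomial in the variable `1 - x`. -/
noncomputable def jcoef (α β : ℝ) (m j : ℕ) : ℝ :=
  (-(1 : ℝ) / 2) ^ j *
      (poch ((m : ℝ) + α + β + 1) j * poch (α + (j : ℝ) + 1) (m - j)) /
      ((j.factorial : ℝ) * ((m - j).factorial : ℝ))

lemma poch_pos {a : ℝ} (ha : 0 < a) (r : ℕ) : 0 < poch a r :=
  Finset.prod_pos (fun i _ => by positivity)

lemma jcoef_ne {α β : ℝ} (hα0 : 0 < α) (hβ0 : 0 < β) (m : ℕ) : jcoef α β m m ≠ 0 := by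
  unfold jcoef
  have h1 := (poch_pos (a := (m : ℝ) + α + β + 1) (by positivity) m).ne'
  have h2 := (poch_pos (a := α + (m : ℝ) + 1) (by positivity) (m - m)).ne'
  have h3 : (m.factorial : ℝ) ≠ 0 := by positivity
  have h4 : ((m - m).factorial : ℝ) ≠ 0 := by positivity
  refine div_ne_zero (mul_ne_zero (pow_ne_zero _ (by norm_num)) (mul_ne_zero h1 h2))
    (mul_ne_zero h3 h4)

noncomputable def jH (α β : ℝ) (n : ℕ) (c : ℕ → ℂ) : Polynomial ℂ :=
  ∑ m ∈ Finset.range n, ∑ j ∈ Finset.range (m + 1),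
    Polynomial.monomial j ((starRingEnd ℂ) (c m) * ((jcoef α β m j : ℝ) : ℂ))

lemma jH_eval (α β : ℝ) (n : ℕ) (c : ℕ → ℂ) (x : ℝ) :
    (starRingEnd ℂ) (∑ m ∈ Finset.range n, c m * ((jacobiP α β m x : ℝ) : ℂ))
      = ((jH α β n c).comp (1 - Polynomial.X)).eval (x : ℂ) := by
  rw [Polynomial.eval_comp, jH, Polynomial.eval_finsetSum, map_sum]
  refine Finset.sum_congr rfl fun m _ => ?_
  rw [Polynomial.eval_finsetSum, map_mul, Complex.conj_ofReal, jacobiP, Complex.ofReal_sum,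
    Finset.mul_sum]
  refine Finset.sum_congr rfl fun j _ => ?_
  rw [Polynomial.eval_monomial]
  simp [jcoef]
  ring

lemma jH_coeff_zero {α β : ℝ} (hα0 : 0 < α) (hβ0 : 0 < β) (n : ℕ) (c : ℕ → ℂ)
    (h : ∀ l < n, (jH α β n c).coeff l = 0) : ∀ m < n, c m = 0 := by
  have key : ∀ d m, m + d + 1 = n → c m = 0 := by
    intro d
    induction d using Nat.strong_induction_on with
    | _ d ih =>
      intro m hm
      have h1 := h m (by omega)
      rw [jH, Polynomial.finsetSum_coeff, Finset.sum_eq_single m] at h1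
      · rw [Polynomial.finsetSum_coeff, Finset.sum_eq_single m] at h1
        · rw [Polynomial.coeff_monomial_same] at h1
          rcases mul_eq_zero.1 h1 with h2 | h2
          · simpa using h2
          · exact absurd (by exact_mod_cast h2) (jcoef_ne hα0 hβ0 m)
        · intro j _ hj
          exact Polynomial.coeff_monomial_of_ne _ (Ne.symm hj)
        · intro hh; simp at hh
      · intro m' hm' hne
        rw [Finset.mem_range] at hm'
        rw [Polynomial.finsetSum_coeff]
        refine Finset.sum_eq_zero fun j hj => ?_
        rw [Finset.mem_range] at hj
        rcases lt_or_gt_of_ne hne with hlt | hgt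
        · exact Polynomial.coeff_monomial_of_ne _ (by omega)
        · rw [ih (n - 1 - m') (by omega) m' (by omega)]
          simp
      · intro hh; exact absurd (Finset.mem_range.2 (by omega)) hh
  intro m hm
  exact key (n - 1 - m) m (by omega)

/-- The Jacobi polynomials `P_0^{(α,β)},…,P_{n-1}^{(α,β)}` are linearly independent
modulo the minimal domain of the `n`-th power of the Jacobi expression: if
`p = Σ c_m P_m^{(α,β)}` satisfies `[f,p]_n |_{-1}^{1} = 0` for all `f` in the maximal
domain, then all `c_m = 0`. -/
theorem jacobi_polynomials_linearly_independent_mod_minimal (α β : ℝ)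
    (hα0 : 0 < α) (hα1 : α < 1) (hβ0 : 0 < β) (hβ1 : β < 1) (n : ℕ) (hn : 1 ≤ n)
    (c : ℕ → ℂ)
    (h : ∀ f : ℝ → ℂ, JacobiMaxDom α β n f →
      ∃ L : ℂ,
        Tendsto (sesqC α β n f
            (fun x : ℝ => ∑ m ∈ Finset.range n, c m * ((jacobiP α β m x : ℝ) : ℂ)))
          (𝓝[<] (1 : ℝ)) (𝓝 L) ∧
        Tendsto (sesqC α β n f
            (fun x : ℝ => ∑ m ∈ Finset.range n, c m * ((jacobiP α β m x : ℝ) : ℂ)))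
          (𝓝[>] (-1 : ℝ)) (𝓝 L)) :
    ∀ m < n, c m = 0 := by
  set G : Polynomial ℂ := (jH α β n c).comp (1 - Polynomial.X) with hG
  have hconj : (fun z : ℝ => (starRingEnd ℂ)
      (∑ m ∈ Finset.range n, c m * ((jacobiP α β m z : ℝ) : ℂ)))
      = fun z : ℝ => G.eval (z : ℂ) := by
    funext z; exact jH_eval α β n c z
  -- the linear relations
  have hrel : ∀ i : ℕ, ∃ D : ℕ → ℕ → ℂ,
      (∀ k j, 1 ≤ j → j ≤ k → (k - j < i → D k j = 0) ∧ (k - j = i → D k j ≠ 0)) ∧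
      ∑ k ∈ Finset.Icc 1 n, ∑ j ∈ Finset.Icc 1 k, (-1 : ℂ) ^ (k + j) *
        (-(D k j * (Polynomial.derivative^[j - 1] G).eval 1)) = 0 := by
    intro i
    have hD : ∀ k j, ∃ D : ℂ, ∀ (hj : 1 ≤ j) (hjk : j ≤ k),
        (k - j < i → D = 0) ∧ (k - j = i → D ≠ 0) ∧ _ := fun k j => by
      by_cases hj : 1 ≤ j
      · by_cases hjk : j ≤ k
        · obtain ⟨D, hD⟩ := term_limits hα0 hα1 hβ0 i k j hj hjk
          exact ⟨D, fun _ _ => ⟨hD.1, hD.2.1, hD.2.2 G⟩⟩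
        · exact ⟨0, fun _ h => absurd h hjk⟩
      · exact ⟨0, fun h => absurd h hj⟩
    choose D hD using hD
    refine ⟨D, fun k j hj hjk => ⟨(hD k j hj hjk).1, (hD k j hj hjk).2.1⟩, ?_⟩
    obtain ⟨L, hL1, hL2⟩ := h _ (maxDom_jW hα1 hβ0 n ((1 - Polynomial.X) ^ i))
    unfold sesqC at hL1 hL2
    rw [hconj] at hL1 hL2
    have hl2 : L = 0 := by
      refine tendsto_nhds_unique hL2 ?_
      have : Tendsto _ (𝓝[>] (-1 : ℝ)) (𝓝 (∑ k ∈ Finset.Icc 1 n, ∑ j ∈ Finset.Icc 1 k,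
          (-1 : ℂ) ^ (k + j) * 0)) :=
        tendsto_finsetSum _ fun k hk => tendsto_finsetSum _ fun j hj =>
          ((hD k j (Finset.mem_Icc.1 hj).1 (Finset.mem_Icc.1 hj).2).2.2.2).const_mul
            ((-1 : ℂ) ^ (k + j))
      simpa only [mul_zero, Finset.sum_const_zero] using this
    rw [hl2] at hL1
    refine tendsto_nhds_unique ?_ hL1
    exact tendsto_finsetSum _ fun k hk => tendsto_finsetSum _ fun j hj =>
          ((hD k j (Finset.mem_Icc.1 hj).1 (Finset.mem_Icc.1 hj).2).2.2.1).const_mul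
            ((-1 : ℂ) ^ (k + j))
  have hder : ∀ l, l < n → (Polynomial.derivative^[l] G).eval 1 = 0 := by
    intro l
    induction l using Nat.strong_induction_on with
    | _ l ih =>
      intro hl
      obtain ⟨D, hD, hsum⟩ := hrel (n - 1 - l)
      have hz : ∀ k j, 1 ≤ j → j ≤ k → k ≤ n → ¬ (k = n ∧ j = l + 1) → (-1 : ℂ) ^ (k + j) *
          (-(D k j * (Polynomial.derivative^[j - 1] G).eval 1)) = 0 := by
        intro k j hj hjk hkn hne
        by_cases hlt : k - j < n - 1 - l
        · rw [(hD k j hj hjk).1 hlt]; simp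
        · rw [ih (j - 1) (by omega) (by omega)]; simp
      rw [Finset.sum_eq_single n, Finset.sum_eq_single (l + 1)] at hsum
      · have hDn := (hD n (l + 1) (by omega) (by omega)).2 (by omega)
        simpa [hDn] using hsum
      · intro j hj hne
        rw [Finset.mem_Icc] at hj
        exact hz n j hj.1 hj.2 le_rfl (by omega)
      · intro hh; exact absurd (Finset.mem_Icc.2 (by omega)) hh
      · intro k hk hne
        rw [Finset.mem_Icc] at hk
        refine Finset.sum_eq_zero fun j hj => ?_
        rw [Finset.mem_Icc] at hj
        exact hz k j hj.1 hj.2 hk.2 (by omega)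
      · intro hh; exact absurd (Finset.mem_Icc.2 (by omega)) hh
  refine jH_coeff_zero hα0 hβ0 n c fun l hl => ?_
  have h1 := hder l hl
  rw [hG, Polynomial.iterate_derivative_comp_one_sub_X] at h1
  have h2 : (Polynomial.derivative^[l] (jH α β n c)).eval 0 = 0 := by
    simpa [Polynomial.eval_comp] using h1
  rw [← Polynomial.coeff_zero_eq_eval_zero, Polynomial.coeff_iterate_derivative] at h2
  simpa [Nat.descFactorial_self, Nat.factorial_ne_zero] using h2
end

section
/- Fix 0 ≤ α, β < 1, n ∈ ℕ and m ∈ ℕ₀, and let f belong to the maximal domain D_max^{J,n}. Assume that for every j = 0, …, m both one-sided limits of [f, P_j^{(α,β)}]_n vanish: lim_{x→1⁻}[f,P_j^{(α,β)}]_n(x) = 0 and lim_{x→-1⁺}[f,P_j^{(α,β)}]_n(x) = 0. Then lim_{x→1⁻}[f,(1-x)^m]_n(x) = 0, lim_{x→-1⁺}[f,(1-x)^m]_n(x) = 0, lim_{x→1⁻}[f,(1+x)^m]_n(x) = 0 and lim_{x→-1⁺}[f,(1+x)^m]_n(x) = 0. -/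
open MeasureTheory Set Filter Topology

open scoped ContDiff in
lemma ak_contDiffAt (α β : ℝ) (k : ℕ) {x : ℝ} (hx : x ∈ Ioo (-1 : ℝ) 1) :
    ContDiffAt ℝ ∞ (fun y => ((ak α β k y : ℝ) : ℂ)) x := by
  have h1 : (1 - x) ≠ 0 := by have := hx.2; intro h; linarith
  have h2 : (1 + x) ≠ 0 := by have := hx.1; intro h; linarith
  have h3 : ContDiffAt ℝ ∞ (fun y => ak α β k y) x := by
    unfold ak
    exact ((contDiffAt_const.sub contDiffAt_id).rpow_const_of_ne h1).mul
      ((contDiffAt_const.add contDiffAt_id).rpow_const_of_ne h2)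
  exact Complex.ofRealCLM.contDiff.contDiffAt.comp x h3

open scoped ContDiff in
lemma contDiff_iterDeriv {g : ℝ → ℂ} (hg : ContDiff ℝ ∞ g) (k : ℕ) :
    ContDiff ℝ ∞ (iteratedDeriv k g) := by
  rw [iteratedDeriv_eq_iterate]
  exact hg.iterate_deriv k

open scoped ContDiff in
lemma natCast_le_infty (k : ℕ) : ((k : ℕ) : WithTop ℕ∞) ≤ ∞ := by
  have : (k : ℕ∞) ≤ ⊤ := le_top
  exact_mod_cast this

open scoped ContDiff in
lemma sesq_add (α β : ℝ) (n : ℕ) (f : ℝ → ℂ) {g h : ℝ → ℂ} (hg : ContDiff ℝ ∞ g)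
    (hh : ContDiff ℝ ∞ h) {x : ℝ} (hx : x ∈ Ioo (-1 : ℝ) 1) :
    sesq α β n f (fun y => g y + h y) x = sesq α β n f g x + sesq α β n f h x := by
  have key : ∀ k, iteratedDeriv k (fun y => g y + h y) =
      fun y => iteratedDeriv k g y + iteratedDeriv k h y := by
    intro k; funext y
    exact iteratedDeriv_fun_add (hg.contDiffAt.of_le (natCast_le_infty _))
      (hh.contDiffAt.of_le (natCast_le_infty _))
  unfold sesq
  rw [← Finset.sum_add_distrib]
  refine Finset.sum_congr rfl fun k _ => ?_
  rw [← Finset.sum_add_distrib]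
  refine Finset.sum_congr rfl fun j _ => ?_
  have e : iteratedDeriv (k - j)
      (fun y => ((ak α β k y : ℝ) : ℂ) * iteratedDeriv k (fun y => g y + h y) y) x =
      iteratedDeriv (k - j) (fun y => ((ak α β k y : ℝ) : ℂ) * iteratedDeriv k g y) x +
      iteratedDeriv (k - j) (fun y => ((ak α β k y : ℝ) : ℂ) * iteratedDeriv k h y) x := by
    rw [key]
    simp only [mul_add]
    exact iteratedDeriv_fun_add
      (((ak_contDiffAt α β k hx).mul (contDiff_iterDeriv hg k).contDiffAt).of_le
        (natCast_le_infty _))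
      (((ak_contDiffAt α β k hx).mul (contDiff_iterDeriv hh k).contDiffAt).of_le
        (natCast_le_infty _))
  rw [e, key]
  ring

lemma sesq_const_mul (α β : ℝ) (n : ℕ) (f : ℝ → ℂ) (c : ℂ) (g : ℝ → ℂ) (x : ℝ) :
    sesq α β n f (fun y => c * g y) x = c * sesq α β n f g x := by
  have key : ∀ k (u : ℝ → ℂ), iteratedDeriv k (fun y => c * u y) =
      fun y => c * iteratedDeriv k u y := by
    intro k u; funext y
    exact iteratedDeriv_const_mul_field c u
  unfold sesq
  rw [Finset.mul_sum]
  refine Finset.sum_congr rfl fun k _ => ?_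
  rw [Finset.mul_sum]
  refine Finset.sum_congr rfl fun j _ => ?_
  simp only [key, mul_left_comm _ c]
  ring

open scoped ContDiff in
/-- Smooth functions pairing to zero with `f` along the filter `l`. -/
def GoodFn (α β : ℝ) (n : ℕ) (f : ℝ → ℂ) (l : Filter ℝ) (g : ℝ → ℝ) : Prop :=
  ContDiff ℝ ∞ (fun x => ((g x : ℝ) : ℂ)) ∧
    Tendsto (sesq α β n f (fun x => ((g x : ℝ) : ℂ))) l (𝓝 0)

lemma GoodFn.add {α β : ℝ} {n : ℕ} {f : ℝ → ℂ} {l : Filter ℝ} (hl : Ioo (-1 : ℝ) 1 ∈ l)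
    {g h : ℝ → ℝ} (hg : GoodFn α β n f l g) (hh : GoodFn α β n f l h) :
    GoodFn α β n f l (fun x => g x + h x) := by
  unfold GoodFn
  simp only [Complex.ofReal_add]
  refine ⟨hg.1.add hh.1, ?_⟩
  have := hg.2.add hh.2
  rw [add_zero] at this
  refine this.congr' ?_
  filter_upwards [hl] with x hx
  exact (sesq_add α β n f hg.1 hh.1 hx).symm

lemma GoodFn.const_mul {α β : ℝ} {n : ℕ} {f : ℝ → ℂ} {l : Filter ℝ}
    {g : ℝ → ℝ} (c : ℝ) (hg : GoodFn α β n f l g) :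
    GoodFn α β n f l (fun x => c * g x) := by
  unfold GoodFn
  simp only [Complex.ofReal_mul]
  refine ⟨contDiff_const.mul hg.1, ?_⟩
  have := hg.2.const_mul (c : ℂ)
  rw [mul_zero] at this
  exact this.congr fun x => (sesq_const_mul α β n f _ _ x).symm

lemma GoodFn.sum {α β : ℝ} {n : ℕ} {f : ℝ → ℂ} {l : Filter ℝ} (hl : Ioo (-1 : ℝ) 1 ∈ l)
    (c : ℕ → ℝ) (g : ℕ → ℝ → ℝ) (N : ℕ) (hg : ∀ j < N, GoodFn α β n f l (g j)) :
    GoodFn α β n f l (fun x => ∑ j ∈ Finset.range N, c j * g j x) := by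
  induction N with
  | zero =>
    simp only [Finset.range_zero, Finset.sum_empty]
    refine ⟨contDiff_const, ?_⟩
    refine tendsto_const_nhds.congr fun x => ?_
    have := sesq_const_mul α β n f 0 (fun _ => 0) x
    simp only [zero_mul] at this
    simpa using this.symm
  | succ N ih =>
    simp only [Finset.sum_range_succ]
    exact (ih fun j hj => hg j (by omega)).add hl ((hg N (by omega)).const_mul _)

lemma good_main (α β : ℝ) (hα0 : 0 ≤ α) (hβ0 : 0 ≤ β) (n m : ℕ) (f : ℝ → ℂ) (l : Filter ℝ)
    (hl : Ioo (-1 : ℝ) 1 ∈ l)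
    (h : ∀ j : ℕ, j ≤ m →
      Tendsto (sesq α β n f (fun x : ℝ => ((jacobiP α β j x : ℝ) : ℂ))) l (𝓝 0)) :
    ∀ j ≤ m, GoodFn α β n f l (fun x => (1 - x) ^ j) := by
  intro j
  induction j using Nat.strong_induction_on with
  | _ j ih =>
  intro hj
  have hP : GoodFn α β n f l (jacobiP α β j) := by
    refine ⟨?_, h j hj⟩
    refine Complex.ofRealCLM.contDiff.comp (?_ : ContDiff ℝ _ (jacobiP α β j))
    unfold jacobiP
    fun_prop
  set c : ℕ → ℝ := fun i => (-(1 : ℝ) / 2) ^ i *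
      (poch ((j : ℝ) + α + β + 1) i * poch (α + (i : ℝ) + 1) (j - i)) /
      ((i.factorial : ℝ) * ((j - i).factorial : ℝ)) with hc
  have hcj : c j ≠ 0 := by
    have h1 : poch ((j : ℝ) + α + β + 1) j ≠ 0 := by
      unfold poch
      exact (Finset.prod_pos fun i _ => by positivity).ne'
    have h2 : poch (α + (j : ℝ) + 1) (j - j) ≠ 0 := by simp [poch]
    have h3 : (-(1 : ℝ) / 2) ^ j ≠ 0 := pow_ne_zero _ (by norm_num)
    simp only [hc]
    positivity
  have hS := GoodFn.sum hl c (fun i x => (1 - x) ^ i) j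
    (fun i hi => ih i hi (by omega))
  have hfin := (hP.add hl (hS.const_mul (-1))).const_mul (c j)⁻¹
  convert hfin using 2 with x
  have : jacobiP α β j x = ∑ i ∈ Finset.range (j + 1), c i * (1 - x) ^ i := rfl
  rw [this, Finset.sum_range_succ]
  field_simp
  ring

lemma good_plus {α β : ℝ} {n m : ℕ} {f : ℝ → ℂ} {l : Filter ℝ}
    (hl : Ioo (-1 : ℝ) 1 ∈ l)
    (h : ∀ j ≤ m, GoodFn α β n f l (fun x => (1 - x) ^ j)) :
    GoodFn α β n f l (fun x => (1 + x) ^ m) := by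
  have := GoodFn.sum hl (fun i => (-1) ^ i * 2 ^ (m - i) * (m.choose i : ℝ))
    (fun i x => (1 - x) ^ i) (m + 1) (fun i hi => h i (by omega))
  convert this using 2 with x
  have e : 1 + x = -(1 - x) + 2 := by ring
  rw [e, add_pow]
  refine Finset.sum_congr rfl fun i _ => ?_
  rw [neg_pow]
  ring

/-- If `[f,P_j^{(α,β)}]_n` vanishes in the limit at both endpoints for every `j = 0,…,m`,
then `[f,(1-x)^m]_n` and `[f,(1+x)^m]_n` vanish in the limit at both endpoints. -/
theorem jacobi_stacking_boundary_conditions (α β : ℝ)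
    (hα0 : 0 ≤ α) (hα1 : α < 1) (hβ0 : 0 ≤ β) (hβ1 : β < 1) (n : ℕ) (hn : 1 ≤ n)
    (m : ℕ) (f : ℝ → ℂ) (hf : JacobiMaxDom α β n f)
    (h : ∀ j : ℕ, j ≤ m →
      Tendsto (sesq α β n f (fun x : ℝ => ((jacobiP α β j x : ℝ) : ℂ)))
        (𝓝[<] (1 : ℝ)) (𝓝 0) ∧
      Tendsto (sesq α β n f (fun x : ℝ => ((jacobiP α β j x : ℝ) : ℂ)))
        (𝓝[>] (-1 : ℝ)) (𝓝 0)) :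
    Tendsto (sesq α β n f (fun x : ℝ => (((1 - x) ^ m : ℝ) : ℂ))) (𝓝[<] (1 : ℝ)) (𝓝 0) ∧
    Tendsto (sesq α β n f (fun x : ℝ => (((1 - x) ^ m : ℝ) : ℂ))) (𝓝[>] (-1 : ℝ)) (𝓝 0) ∧
    Tendsto (sesq α β n f (fun x : ℝ => (((1 + x) ^ m : ℝ) : ℂ))) (𝓝[<] (1 : ℝ)) (𝓝 0) ∧
    Tendsto (sesq α β n f (fun x : ℝ => (((1 + x) ^ m : ℝ) : ℂ))) (𝓝[>] (-1 : ℝ)) (𝓝 0) := by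
  have hl1 : Ioo (-1 : ℝ) 1 ∈ 𝓝[<] (1 : ℝ) := Ioo_mem_nhdsLT (by norm_num)
  have hl2 : Ioo (-1 : ℝ) 1 ∈ 𝓝[>] (-1 : ℝ) := Ioo_mem_nhdsGT (by norm_num)
  have g1 := good_main α β hα0 hβ0 n m f _ hl1 fun j hj => (h j hj).1
  have g2 := good_main α β hα0 hβ0 n m f _ hl2 fun j hj => (h j hj).2
  exact ⟨(g1 m le_rfl).2, (g2 m le_rfl).2, (good_plus hl1 g1).2, (good_plus hl2 g2).2⟩
end
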